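/- arXiv:2112.07816 — 4 statements merged into one kernel-verified Lean document; each statement's English description precedes it below -/
import Mathlib

section
/- For every ε > 0 there exists a constant C > 0 such that for every integer n ≥ 3, the set of conjugacy classes of SL(2,ℤ) consisting of matrices of trace n is finite and has cardinality at most C·n^{1+ε}. -/
/-- The set of conjugacy classes of `SL(2, ℤ)` all of whose representative
matrices have trace `n`. -/
def traceConjClasses (n : ℤ) :
    Set (ConjClasses (Matrix.SpecialLinearGroup (Fin 2) ℤ)) :=
  {c | ∀ g ∈ c.carrier, Matrix.trace (g : Matrix (Fin 2) (Fin 2) ℤ) = n}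

/-- Divisor bound. -/
theorem divisor_bound_aux (δ : ℝ) (hδ : 0 < δ) :
    ∃ C : ℝ, 1 ≤ C ∧ ∀ m : ℕ, m ≠ 0 → ((m.divisors.card : ℕ) : ℝ) ≤ C * (m : ℝ) ^ δ := by
  obtain ⟨P, hP⟩ := exists_nat_ge ((2 : ℝ) ^ (1 / δ))
  have hl2 : 0 < Real.log 2 := Real.log_pos (by norm_num)
  set A : ℝ := max 1 (1 / (δ * Real.log 2)) with hA
  have hA1 : 1 ≤ A := le_max_left _ _
  have hA2 : 1 ≤ A * (δ * Real.log 2) := by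
    have : 1 / (δ * Real.log 2) ≤ A := le_max_right _ _
    rwa [div_le_iff₀ (by positivity)] at this
  have key : ∀ p k : ℕ, 2 ≤ p →
      ((k + 1 : ℕ) : ℝ) ≤ (if p < P then A else 1) * ((p : ℝ) ^ k) ^ δ := by
    intro p k hp
    have hp' : (2 : ℝ) ≤ p := by exact_mod_cast hp
    have hcomm : ((p : ℝ) ^ k) ^ δ = ((p : ℝ) ^ δ) ^ k := by
      rw [← Real.rpow_natCast, ← Real.rpow_natCast, ← Real.rpow_mul (by positivity),
        ← Real.rpow_mul (by positivity), mul_comm]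
    split_ifs with h
    · have h1 : ((2 : ℝ) ^ k) ^ δ ≤ ((p : ℝ) ^ k) ^ δ := by gcongr
      have h2 : 1 + k * (δ * Real.log 2) ≤ ((2 : ℝ) ^ k) ^ δ := by
        rw [Real.rpow_def_of_pos (by positivity), Real.log_pow]
        have := Real.add_one_le_exp (k * Real.log 2 * δ)
        linarith
      have h3 : (k : ℝ) * 1 ≤ k * (A * (δ * Real.log 2)) := by gcongr
      have h4 : A * (1 + k * (δ * Real.log 2)) ≤ A * ((p : ℝ) ^ k) ^ δ := by
        gcongr; exact h2.trans h1
      push_cast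
      nlinarith
    · rw [hcomm, one_mul]
      have h1 : (2 : ℝ) ≤ (p : ℝ) ^ δ := by
        have h2 : (2 : ℝ) ^ (1 / δ) ≤ p := hP.trans (by exact_mod_cast not_lt.mp h)
        calc (2 : ℝ) = ((2 : ℝ) ^ (1 / δ)) ^ δ := by
              rw [← Real.rpow_mul (by norm_num)]; field_simp; simp
          _ ≤ _ := by gcongr
      have h2 : (2 : ℝ) ^ k ≤ ((p : ℝ) ^ δ) ^ k := by gcongr
      have h3 : k + 1 ≤ 2 ^ k := Nat.lt_two_pow_self
      have h4 : ((k + 1 : ℕ) : ℝ) ≤ 2 ^ k := by exact_mod_cast h3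
      linarith
  refine ⟨A ^ P, one_le_pow₀ hA1, fun m hm => ?_⟩
  rw [Nat.card_divisors hm, Nat.cast_prod]
  have hmprod : (m : ℝ) = ∏ p ∈ m.primeFactors, (p : ℝ) ^ (m.factorization p) := by
    have := Nat.prod_factorization_pow_eq_self hm
    conv_lhs => rw [← this]
    rw [Finsupp.prod, Nat.support_factorization]
    push_cast
    rfl
  calc _ ≤ ∏ p ∈ m.primeFactors, ((if p < P then A else 1) *
          ((p : ℝ) ^ (m.factorization p)) ^ δ) :=
        Finset.prod_le_prod (fun _ _ => by positivity)
          (fun p hp => key p _ (Nat.prime_of_mem_primeFactors hp).two_le)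
    _ = (∏ p ∈ m.primeFactors, (if p < P then A else 1)) * (m : ℝ) ^ δ := by
        rw [Finset.prod_mul_distrib, Real.finsetProd_rpow _ _ (fun _ _ => by positivity),
          ← hmprod]
    _ ≤ A ^ P * (m : ℝ) ^ δ := by
        gcongr
        rw [← Finset.prod_filter, Finset.prod_const]
        apply pow_le_pow_right₀ hA1
        calc _ ≤ (Finset.range P).card := Finset.card_le_card (by
                intro p hp
                simp only [Finset.mem_filter] at hp
                simpa using hp.2)
          _ = P := by simp

/-- Every class of trace `n ≥ 3` has a reduced representative. -/
theorem exists_reduced_aux (n : ℤ) (hn : 3 ≤ n)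
    (c : ConjClasses (Matrix.SpecialLinearGroup (Fin 2) ℤ)) (hc : c ∈ traceConjClasses n) :
    ∃ g : Matrix.SpecialLinearGroup (Fin 2) ℤ, ConjClasses.mk g = c ∧
      g 0 0 + g 1 1 = n ∧ g 0 0 * g 1 1 - g 0 1 * g 1 0 = 1 ∧
      0 ≤ g 0 0 ∧ g 0 0 ≤ n ∧ 0 < g 0 1 * g 1 0 := by
  classical
  have hdet : ∀ g : Matrix.SpecialLinearGroup (Fin 2) ℤ,
      g 0 0 * g 1 1 - g 0 1 * g 1 0 = 1 := fun g => by
    rw [← Matrix.det_fin_two]; exact g.2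
  have htr : ∀ g : Matrix.SpecialLinearGroup (Fin 2) ℤ, ConjClasses.mk g = c →
      g 0 0 + g 1 1 = n := fun g hg => by
    rw [← Matrix.trace_fin_two]
    exact hc g (ConjClasses.mem_carrier_iff_mk_eq.2 hg)
  have hex : ∃ k : ℕ, ∃ g : Matrix.SpecialLinearGroup (Fin 2) ℤ,
      ConjClasses.mk g = c ∧ (g 1 0).natAbs = k := by
    obtain ⟨g, hg⟩ := ConjClasses.exists_rep c
    exact ⟨_, g, hg, rfl⟩
  obtain ⟨g, hg, hgk⟩ := Nat.find_spec hex
  have hmin : ∀ g' : Matrix.SpecialLinearGroup (Fin 2) ℤ, ConjClasses.mk g' = c →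
      (g 1 0).natAbs ≤ (g' 1 0).natAbs := fun g' hg' => by
    rw [hgk]; exact Nat.find_min' hex ⟨g', hg', rfl⟩
  have hc0 : g 1 0 ≠ 0 := by
    intro h0
    have h1 := hdet g
    have h2 := htr g hg
    rw [h0, mul_zero, sub_zero] at h1
    rcases Int.eq_one_or_neg_one_of_mul_eq_one' h1 with h | h <;> omega
  -- translate
  set t := g 1 1 - g 0 0 with ht
  set k := (t + |g 1 0|) / (2 * g 1 0) with hk
  let T : Matrix.SpecialLinearGroup (Fin 2) ℤ := ⟨!![1, k; 0, 1], by simp [Matrix.det_fin_two]⟩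
  let S : Matrix.SpecialLinearGroup (Fin 2) ℤ := ⟨!![0, -1; 1, 0], by simp [Matrix.det_fin_two]⟩
  set g' := T * g * T⁻¹ with hg'
  have hmk : ConjClasses.mk g' = c := by
    rw [← hg, ConjClasses.mk_eq_mk_iff_isConj]
    exact (isConj_iff.2 ⟨T, rfl⟩).symm
  have hmk2 : ConjClasses.mk (S * g' * S⁻¹) = c := by
    rw [← hmk, ConjClasses.mk_eq_mk_iff_isConj]
    exact (isConj_iff.2 ⟨S, rfl⟩).symm
  have hTm : (T : Matrix (Fin 2) (Fin 2) ℤ) = !![1, k; 0, 1] := rfl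
  have hSm : (S : Matrix (Fin 2) (Fin 2) ℤ) = !![0, -1; 1, 0] := rfl
  have e10 : g' 1 0 = g 1 0 := by
    rw [hg', Matrix.SpecialLinearGroup.coe_mul, Matrix.SpecialLinearGroup.coe_mul,
      Matrix.SpecialLinearGroup.coe_inv, hTm, Matrix.adjugate_fin_two]
    simp [Matrix.mul_apply, Fin.sum_univ_two, Matrix.vecMul, dotProduct]
  have e00 : g' 0 0 = g 0 0 + k * g 1 0 := by
    rw [hg', Matrix.SpecialLinearGroup.coe_mul, Matrix.SpecialLinearGroup.coe_mul,
      Matrix.SpecialLinearGroup.coe_inv, hTm, Matrix.adjugate_fin_two]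
    simp [Matrix.mul_apply, Fin.sum_univ_two, Matrix.vecMul, dotProduct]
  have eS : (S * g' * S⁻¹) 1 0 = - g' 0 1 := by
    rw [Matrix.SpecialLinearGroup.coe_mul, Matrix.SpecialLinearGroup.coe_mul,
      Matrix.SpecialLinearGroup.coe_inv, hSm, Matrix.adjugate_fin_two]
    simp [Matrix.mul_apply, Fin.sum_univ_two, Matrix.vecMul, dotProduct]
  have hS := hmin _ hmk2
  rw [eS, Int.natAbs_neg] at hS
  have hbc : |g' 1 0| ≤ |g' 0 1| := by rw [e10, Int.abs_eq_natAbs, Int.abs_eq_natAbs]; exact_mod_cast hS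
  have h1 := hdet g'
  have h2 := htr g' hmk
  have h2' := htr g hg
  have hm1 := Int.emod_nonneg (t + |g 1 0|) (b := 2 * g 1 0) (by omega)
  have hm2 := Int.emod_lt_abs (t + |g 1 0|) (b := 2 * g 1 0) (by omega)
  have hm3 := Int.emod_add_mul_ediv (t + |g 1 0|) (2 * g 1 0)
  rw [← hk] at hm3
  rw [abs_mul] at hm2
  norm_num at hm2
  have htt : g' 1 1 - g' 0 0 = t - 2 * g 1 0 * k := by linarith
  have habs : |g' 1 1 - g' 0 0| ≤ |g' 1 0| := by
    rw [htt, e10, abs_le]; constructor <;> linarith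
  refine ⟨g', hmk, h2, h1, ?_⟩
  clear_value g' k t
  generalize g' 0 0 = a at *
  generalize g' 0 1 = b at *
  generalize g' 1 0 = c at *
  generalize g' 1 1 = d at *
  have hq : (d - a) ^ 2 ≤ |b * c| := by
    rw [← sq_abs, abs_mul]
    nlinarith [abs_nonneg (d - a), abs_nonneg b, abs_nonneg c]
  have hD : n ^ 2 - 4 = (d - a) ^ 2 + 4 * (b * c) := by
    rw [← h2]; linear_combination 4 * h1
  have hpos : 0 < b * c := by
    by_contra hneg
    rw [abs_of_nonpos (not_lt.mp hneg)] at hq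
    nlinarith
  have hlt : (d - a) ^ 2 ≤ n ^ 2 := by nlinarith
  have := abs_le_of_sq_le_sq' hlt (by omega)
  refine ⟨?_, ?_, hpos⟩ <;> omega

theorem conjClasses_trace_card_bound (ε : ℝ) (hε : 0 < ε) :
    ∃ C : ℝ, 0 < C ∧ ∀ n : ℤ, 3 ≤ n →
      (traceConjClasses n).Finite ∧
        ((traceConjClasses n).ncard : ℝ) ≤ C * (n : ℝ) ^ (1 + ε) := by
  classical
  obtain ⟨C, hC1, hC⟩ := divisor_bound_aux (ε / 2) (by positivity)
  refine ⟨4 * C, by positivity, fun n hn => ?_⟩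
  choose! F hF using exists_reduced_aux n hn
  let D : ℤ → Finset ℤ := fun a =>
    ((a * (n - a) - 1).toNat.divisors.image (fun x : ℕ => (x : ℤ))) ∪
      ((a * (n - a) - 1).toNat.divisors.image (fun x : ℕ => -(x : ℤ)))
  let B : Finset (Σ _ : ℤ, ℤ) := (Finset.Icc 0 n).sigma D
  let φ : ConjClasses (Matrix.SpecialLinearGroup (Fin 2) ℤ) → (Σ _ : ℤ, ℤ) :=
    fun c => ⟨F c 0 0, F c 1 0⟩
  have hmaps : ∀ c ∈ traceConjClasses n, φ c ∈ (B : Set (Σ _ : ℤ, ℤ)) := by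
    intro c hc
    obtain ⟨-, h1, h2, h3, h4, h5⟩ := hF c hc
    have hbc : F c 0 0 * (n - F c 0 0) - 1 = F c 0 1 * F c 1 0 := by
      rw [← h1]; linear_combination h2
    simp only [B, φ, D, Finset.coe_sigma, Set.mem_sigma_iff, Finset.coe_Icc, Set.mem_Icc,
      Finset.mem_coe, Finset.mem_union, Finset.mem_image]
    refine ⟨⟨h3, h4⟩, ?_⟩
    rw [hbc]
    have hmem : (F c 1 0).natAbs ∈ (F c 0 1 * F c 1 0).toNat.divisors := by
      rw [Nat.mem_divisors]
      refine ⟨?_, by omega⟩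
      rw [← Int.natCast_dvd_natCast, Int.toNat_of_nonneg h5.le, Int.natAbs_dvd]
      exact Dvd.intro_left _ rfl
    rcases le_total 0 (F c 1 0) with h | h
    · left; exact ⟨_, hmem, by omega⟩
    · right; exact ⟨_, hmem, by omega⟩
  have hinj : Set.InjOn φ (traceConjClasses n) := by
    intro c hc c' hc' h
    obtain ⟨m, h1, h2, -, -, h5⟩ := hF c hc
    obtain ⟨m', h1', h2', -, -, h5'⟩ := hF c' hc'
    simp only [φ, Sigma.mk.injEq, heq_eq_eq] at h
    obtain ⟨ha, hcc⟩ := h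
    have hd : F c 1 1 = F c' 1 1 := by omega
    have hb : F c 0 1 = F c' 0 1 := by
      have hne : F c 1 0 ≠ 0 := by
        intro h0; rw [h0] at h5; simp at h5
      apply mul_right_cancel₀ hne
      rw [ha, hd] at h2
      rw [← hcc] at h2'
      linarith
    rw [← m, ← m']
    congr 1
    ext i j
    fin_cases i <;> fin_cases j <;> assumption
  refine ⟨Set.Finite.of_injOn hmaps hinj B.finite_toSet, ?_⟩
  have hcard : (traceConjClasses n).ncard ≤ B.card := by
    have := Set.ncard_le_ncard_of_injOn φ hmaps hinj B.finite_toSet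
    rwa [Set.ncard_coe_finset] at this
  have hn0 : (0 : ℝ) < n := by exact_mod_cast (by omega : 0 < n)
  have hn3 : (3 : ℝ) ≤ n := by exact_mod_cast hn
  have hDc : ∀ a ∈ Finset.Icc 0 n, ((D a).card : ℝ) ≤ 2 * (C * (n : ℝ) ^ ε) := by
    intro a ha
    rw [Finset.mem_Icc] at ha
    set m := (a * (n - a) - 1).toNat with hm
    have h1 : (D a).card ≤ 2 * m.divisors.card := by
      refine (Finset.card_union_le _ _).trans ?_
      rw [two_mul]
      exact add_le_add Finset.card_image_le Finset.card_image_le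
    have h1' : ((D a).card : ℝ) ≤ 2 * (m.divisors.card : ℝ) := by exact_mod_cast h1
    refine h1'.trans ?_
    gcongr
    by_cases hm0 : m = 0
    · rw [hm0]; simp; positivity
    refine (hC m hm0).trans ?_
    gcongr
    have h2 : (m : ℤ) ≤ n ^ 2 := by
      have : (m : ℤ) = a * (n - a) - 1 := by omega
      rw [this]; nlinarith
    have h3 : (m : ℝ) ≤ (n : ℝ) ^ 2 := by exact_mod_cast h2
    calc (m : ℝ) ^ (ε / 2) ≤ ((n : ℝ) ^ 2) ^ (ε / 2) := by gcongr
      _ = (n : ℝ) ^ ε := by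
        rw [← Real.rpow_natCast, ← Real.rpow_mul hn0.le]; congr 1; push_cast; ring
  have hB : (B.card : ℝ) ≤ (n + 1) * (2 * (C * (n : ℝ) ^ ε)) := by
    rw [Finset.card_sigma, Nat.cast_sum]
    refine (Finset.sum_le_sum hDc).trans ?_
    rw [Finset.sum_const, Int.card_Icc, nsmul_eq_mul]
    apply le_of_eq
    congr 1
    have : ((n + 1 - 0).toNat : ℤ) = n + 1 := by omega
    exact_mod_cast this
  calc ((traceConjClasses n).ncard : ℝ) ≤ B.card := by exact_mod_cast hcard
    _ ≤ _ := hB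
    _ ≤ (2 * n) * (2 * (C * (n : ℝ) ^ ε)) := by gcongr; linarith
    _ = 4 * C * (n : ℝ) ^ (1 + ε) := by
      rw [Real.rpow_add hn0, Real.rpow_one]; ring
end

section
/- For every integer n ≥ 3, the set of conjugacy classes of SL(2,ℤ) consisting of matrices of trace n is finite. -/
/-- Bounds for the entries of a reduced matrix. -/
lemma reduced_bounds (n a b c d : ℤ) (hn : 3 ≤ n) (hc : c ≠ 0) (hbc : |c| ≤ |b|)
    (hac : |a - d| ≤ |c|) (ht : a + d = n) (hd : a * d - b * c = 1) :
    |a| ≤ n ^ 2 ∧ |b| ≤ n ^ 2 ∧ |c| ≤ n ^ 2 ∧ |d| ≤ n ^ 2 := by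
  have key : (a - d) ^ 2 + 4 * (b * c) = n ^ 2 - 4 := by
    rw [← ht]; linear_combination -4 * hd
  have hc1 : 1 ≤ |c| := Int.one_le_abs hc
  have h1 : (a - d) ^ 2 ≤ |c| ^ 2 := by
    rw [← sq_abs (a - d)]; exact pow_le_pow_left₀ (abs_nonneg _) hac 2
  have h2 : |c| ^ 2 ≤ |b| * |c| := by nlinarith
  have h3 : |b| * |c| = b * c := by
    rw [← abs_mul]
    rcases abs_choice (b * c) with h | h
    · exact h
    · exfalso
      rw [← abs_mul] at h2
      nlinarith
  have h4 : |b| ≤ |b| * |c| := by nlinarith [abs_nonneg b]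
  have h5 : |b| ≤ n ^ 2 := by nlinarith [sq_nonneg (a - d), abs_nonneg b]
  have h6 : |a - d| ≤ n := by
    refine abs_le_of_sq_le_sq ?_ (by omega)
    nlinarith [sq_nonneg |c|]
  have h7 := abs_le.1 h6
  have h8 : n ≤ n ^ 2 := by nlinarith
  refine ⟨abs_le.2 ⟨?_, ?_⟩, h5, hbc.trans h5, abs_le.2 ⟨?_, ?_⟩⟩ <;> omega

/-- Every conjugacy class of trace `n ≥ 3` has a representative with entries bounded by `n ^ 2`. -/
lemma exists_bounded_rep (n : ℤ) (hn : 3 ≤ n) (g : Matrix.SpecialLinearGroup (Fin 2) ℤ)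
    (hg : Matrix.trace (g : Matrix (Fin 2) (Fin 2) ℤ) = n) :
    ∃ h : Matrix.SpecialLinearGroup (Fin 2) ℤ, IsConj g h ∧ ∀ i j, |h.1 i j| ≤ n ^ 2 := by
  -- choose a conjugate with minimal lower left entry
  obtain ⟨h, hh, hmin⟩ : ∃ h, IsConj g h ∧
      ∀ h', IsConj g h' → (h.1 1 0).natAbs ≤ (h'.1 1 0).natAbs := by
    let S : Set (Matrix.SpecialLinearGroup (Fin 2) ℤ) := {h | IsConj g h}
    have hS : S.Nonempty := ⟨g, IsConj.refl g⟩
    refine ⟨Function.argminOn (fun h => (h.1 1 0).natAbs) S hS,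
      Function.argminOn_mem (fun h : Matrix.SpecialLinearGroup (Fin 2) ℤ => (h.1 1 0).natAbs) S hS, fun h' hh' => ?_⟩
    exact Function.argminOn_le (fun h => (h.1 1 0).natAbs) S hh'
  have htr : ∀ h', IsConj g h' → h'.1 0 0 + h'.1 1 1 = n := by
    intro h' hh'
    obtain ⟨u, rfl⟩ := isConj_iff.1 hh'
    have : Matrix.trace (u * g * u⁻¹).1 = n := by
      rw [← hg, Matrix.SpecialLinearGroup.coe_mul, Matrix.trace_mul_comm,
        ← Matrix.SpecialLinearGroup.coe_mul]
      simp
    rwa [Matrix.trace_fin_two] at this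
  have hdet : ∀ h' : Matrix.SpecialLinearGroup (Fin 2) ℤ,
      h'.1 0 0 * h'.1 1 1 - h'.1 0 1 * h'.1 1 0 = 1 := by
    intro h'
    have := h'.2
    rwa [Matrix.det_fin_two] at this
  have hc : h.1 1 0 ≠ 0 := by
    intro h0
    have h1 := hdet h
    have h2 := htr h hh
    rw [h0, mul_zero, sub_zero] at h1
    rcases Int.mul_eq_one_iff_eq_one_or_neg_one.1 h1 with h3 | h3 <;> omega
  -- translate
  let q : ℤ := (h.1 0 0 - h.1 1 1 + |h.1 1 0|) / (2 * h.1 1 0)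
  let m := ModularGroup.T ^ (-q) * h * (ModularGroup.T ^ (-q))⁻¹
  have hm : IsConj g m := hh.trans (isConj_iff.2 ⟨_, rfl⟩)
  have hm10 : m.1 1 0 = h.1 1 0 := by
    simp [m, ← zpow_neg, ModularGroup.coe_T_zpow, Matrix.mul_apply, Fin.sum_univ_two, Matrix.vecMul, dotProduct]
  have hm00 : m.1 0 0 = h.1 0 0 - q * h.1 1 0 := by
    simp [m, ← zpow_neg, ModularGroup.coe_T_zpow, Matrix.mul_apply, Fin.sum_univ_two, Matrix.vecMul, dotProduct]
    try ring
  have hm11 : m.1 1 1 = h.1 1 1 + q * h.1 1 0 := by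
    have := htr h hh
    have := htr m hm
    linarith
  have hs := hmin (ModularGroup.S * m * ModularGroup.S⁻¹) (hm.trans (isConj_iff.2 ⟨_, rfl⟩))
  have hs' : (ModularGroup.S * m * ModularGroup.S⁻¹).1 1 0 = - m.1 0 1 := by
    simp [ModularGroup.coe_S, Matrix.mul_apply, Fin.sum_univ_two, Matrix.vecMul, dotProduct, Matrix.adjugate_fin_two]
  rw [hs', ← hm10, Int.natAbs_neg] at hs
  have hbc : |m.1 1 0| ≤ |m.1 0 1| := by
    rw [Int.abs_eq_natAbs, Int.abs_eq_natAbs]; exact_mod_cast hs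
  have hac : |m.1 0 0 - m.1 1 1| ≤ |m.1 1 0| := by
    have e1 := Int.emod_nonneg (h.1 0 0 - h.1 1 1 + |h.1 1 0|) (b := 2 * h.1 1 0) (by omega)
    have e2 := Int.emod_lt_abs (h.1 0 0 - h.1 1 1 + |h.1 1 0|) (b := 2 * h.1 1 0) (by omega)
    have e3 := Int.emod_add_mul_ediv (h.1 0 0 - h.1 1 1 + |h.1 1 0|) (2 * h.1 1 0)
    change _ + 2 * h.1 1 0 * q = _ at e3
    rw [abs_mul, abs_two] at e2
    rw [hm00, hm11, hm10, abs_le]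
    constructor <;> linarith
  have ht := htr m hm
  have hd := hdet m
  rw [← hm10] at hc
  refine ⟨m, hm, ?_⟩
  obtain ⟨h1, h2, h3, h4⟩ := reduced_bounds n _ _ _ _ hn hc hbc hac ht hd
  intro i j
  fin_cases i <;> fin_cases j
  exacts [h1, h2, h3, h4]

/-- For every integer `n ≥ 3`, the set of conjugacy classes of `SL(2, ℤ)`
consisting of matrices of trace `n` is finite. -/
theorem conjClasses_trace_finite (n : ℤ) (hn : 3 ≤ n) :
    {c : ConjClasses (Matrix.SpecialLinearGroup (Fin 2) ℤ) |
      ∀ g ∈ c.carrier, Matrix.trace (g : Matrix (Fin 2) (Fin 2) ℤ) = n}.Finite := by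
  have hfin : {h : Matrix.SpecialLinearGroup (Fin 2) ℤ | ∀ i j, |h.1 i j| ≤ n ^ 2}.Finite := by
    have h1 : (Set.univ.pi fun _ : Fin 2 => Set.univ.pi fun _ : Fin 2 =>
        Set.Icc (-(n ^ 2)) (n ^ 2)).Finite :=
      Set.Finite.pi fun _ => Set.Finite.pi fun _ => Set.finite_Icc _ _
    refine Set.Finite.of_finite_image (f := fun h => h.1) (h1.subset ?_)
      Subtype.val_injective.injOn
    rintro _ ⟨h, hh, rfl⟩ i - j -
    exact abs_le.1 (hh i j)
  refine (hfin.image ConjClasses.mk).subset ?_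
  intro c hc
  obtain ⟨g, rfl⟩ := ConjClasses.exists_rep c
  obtain ⟨h, hgh, hb⟩ := exists_bounded_rep n hn g (hc g ConjClasses.mem_carrier_mk)
  exact ⟨h, hb, (ConjClasses.mk_eq_mk_iff_isConj.2 hgh).symm⟩
end

section
/- Let a, b, c be integers with gcd(a,b,c) = 1, and let t, u be positive integers with t² − (b² − 4ac)·u² = 4. Let γ be the matrix with rows ((t+bu)/2, −cu) and (au, (t−bu)/2). Then the trace of γ equals t, and gcd(γ₂₁, γ₁₁ − γ₂₂, −γ₁₂) = u, and (γ₂₁/u, (γ₁₁ − γ₂₂)/u, −γ₁₂/u) = (a, b, c). -/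
/-- For a primitive form `[a,b,c]` (i.e. `gcd(a,b,c) = 1`) and a positive solution `(t,u)`
of `t² - (b² - 4ac)u² = 4`, the matrix `γ = [[(t+bu)/2, -cu],[au,(t-bu)/2]]` satisfies
`tr γ = t`, `gcd(γ₂₁, γ₁₁ - γ₂₂, -γ₁₂) = u` and `(γ₂₁/u, (γ₁₁-γ₂₂)/u, -γ₁₂/u) = (a,b,c)`. -/
theorem quadratic_form_matrix_round_trip (a b c t u : ℤ)
    (hprim : Int.gcd a (Int.gcd b c) = 1) (ht : 0 < t) (hu : 0 < u)
    (h : t ^ 2 - (b ^ 2 - 4 * a * c) * u ^ 2 = 4) :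
    ∀ γ : Matrix (Fin 2) (Fin 2) ℤ,
      γ = !![(t + b * u) / 2, -(c * u); a * u, (t - b * u) / 2] →
      Matrix.trace γ = t ∧
        (Int.gcd (γ 1 0) (Int.gcd (γ 0 0 - γ 1 1) (-γ 0 1)) : ℤ) = u ∧
        γ 1 0 / u = a ∧ (γ 0 0 - γ 1 1) / u = b ∧ -γ 0 1 / u = c := by
  intro γ hγ
  have hev : Even ((t + b * u) * (t - b * u)) := ⟨2 - 2 * a * c * u ^ 2, by linear_combination h⟩
  have hp : Even (t + b * u) := by
    rcases Int.even_mul.mp hev with h1 | h1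
    · exact h1
    · have h2 : t + b * u = (t - b * u) + 2 * (b * u) := by ring
      rw [h2]
      exact h1.add (even_two_mul _)
  obtain ⟨k, hk⟩ := hp
  have e1 : (t + b * u) / 2 = k := by omega
  have e2 : (t - b * u) / 2 = k - b * u := by omega
  have h00 : γ 0 0 = k := by rw [hγ]; simpa using e1
  have h11 : γ 1 1 = k - b * u := by rw [hγ]; simpa using e2
  have h01 : γ 0 1 = -(c * u) := by rw [hγ]; simp
  have h10 : γ 1 0 = a * u := by rw [hγ]; simp
  have hd : γ 0 0 - γ 1 1 = b * u := by rw [h00, h11]; ring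
  have hne : u ≠ 0 := hu.ne'
  refine ⟨?_, ?_, ?_, ?_, ?_⟩
  · rw [Matrix.trace_fin_two, h00, h11]; linarith
  · rw [hd, h10, h01, neg_neg, Int.gcd_mul_right]
    have hn : ((Int.gcd b c * u.natAbs : ℕ) : ℤ) = (Int.gcd b c : ℤ) * u := by
      rw [Nat.cast_mul, Int.natAbs_of_nonneg hu.le]
    rw [hn, Int.gcd_mul_right, hprim, one_mul, Int.natAbs_of_nonneg hu.le]
  · rw [h10, Int.mul_ediv_cancel _ hne]
  · rw [hd, Int.mul_ediv_cancel _ hne]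
  · rw [h01, neg_neg, Int.mul_ediv_cancel _ hne]
end

section
/- Let n₁, n₂ be integers with 3 ≤ n₁ < n₂, and set ε(n) := (n + √(n² − 4))/2. Then ε(n₂) − ε(n₁) ≥ n₂ − n₁. Moreover, if n₂ < 2n₁ then log(ε(n₂)/ε(n₁)) ≥ (n₂ − n₁)/(3n₁), and if n₂ ≥ 2n₁ then log(ε(n₂)/ε(n₁)) ≥ 1/2. -/
/-- For integers `3 ≤ n₁ < n₂` and `ε(n) = (n + √(n² - 4))/2`:
`ε(n₂) - ε(n₁) ≥ n₂ - n₁`; if `n₂ < 2n₁` then `log(ε(n₂)/ε(n₁)) ≥ (n₂ - n₁)/(3n₁)`;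
and if `n₂ ≥ 2n₁` then `log(ε(n₂)/ε(n₁)) ≥ 1/2`. -/
theorem eps_log_ratio_bounds (n₁ n₂ : ℤ) (h₁ : 3 ≤ n₁) (h₂ : n₁ < n₂) :
    (((n₂ : ℝ) + Real.sqrt ((n₂ : ℝ) ^ 2 - 4)) / 2
        - ((n₁ : ℝ) + Real.sqrt ((n₁ : ℝ) ^ 2 - 4)) / 2 ≥ (n₂ : ℝ) - (n₁ : ℝ)) ∧
      (n₂ < 2 * n₁ →
        Real.log ((((n₂ : ℝ) + Real.sqrt ((n₂ : ℝ) ^ 2 - 4)) / 2)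
            / (((n₁ : ℝ) + Real.sqrt ((n₁ : ℝ) ^ 2 - 4)) / 2))
          ≥ ((n₂ : ℝ) - (n₁ : ℝ)) / (3 * (n₁ : ℝ))) ∧
      (2 * n₁ ≤ n₂ →
        Real.log ((((n₂ : ℝ) + Real.sqrt ((n₂ : ℝ) ^ 2 - 4)) / 2)
            / (((n₁ : ℝ) + Real.sqrt ((n₁ : ℝ) ^ 2 - 4)) / 2)) ≥ 1 / 2) := by
  have ha : (3 : ℝ) ≤ n₁ := by exact_mod_cast h₁
  have hab : (n₁ : ℝ) < n₂ := by exact_mod_cast h₂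
  have hc1 : n₂ < 2 * n₁ → (n₂ : ℝ) < 2 * n₁ := fun h => by exact_mod_cast h
  have hc2 : 2 * n₁ ≤ n₂ → 2 * (n₁ : ℝ) ≤ n₂ := fun h => by exact_mod_cast h
  generalize (n₁ : ℝ) = a at *
  generalize (n₂ : ℝ) = b at *
  have hs0 := Real.sqrt_nonneg (a ^ 2 - 4)
  have hss : Real.sqrt (a ^ 2 - 4) ^ 2 = a ^ 2 - 4 := Real.sq_sqrt (by nlinarith)
  have hsa : Real.sqrt (a ^ 2 - 4) ≤ a := by
    rw [Real.sqrt_le_left (by linarith)]; linarith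
  have hst : Real.sqrt (a ^ 2 - 4) + (b - a) ≤ Real.sqrt (b ^ 2 - 4) := by
    apply Real.le_sqrt_of_sq_le
    nlinarith [mul_nonneg (sub_nonneg.2 hsa) (sub_nonneg.2 hab.le)]
  generalize Real.sqrt (a ^ 2 - 4) = s at *
  generalize Real.sqrt (b ^ 2 - 4) = t at *
  have ha0 : 0 < a := by linarith
  have hb0 : 0 < b := by linarith
  have hr : b / a ≤ ((b + t) / 2) / ((a + s) / 2) := by
    rw [div_le_div_iff₀ ha0 (by linarith)]
    nlinarith [mul_nonneg (sub_nonneg.2 hsa) (sub_nonneg.2 hab.le),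
      mul_nonneg ha0.le (sub_nonneg.2 hst)]
  have hlog : 1 - a / b ≤ Real.log (((b + t) / 2) / ((a + s) / 2)) := by
    have h1 := Real.one_sub_inv_le_log_of_pos (div_pos hb0 ha0)
    rw [inv_div] at h1
    exact h1.trans (Real.log_le_log (div_pos hb0 ha0) hr)
  refine ⟨by linarith, fun h => ge_iff_le.2 (le_trans ?_ hlog),
    fun h => ge_iff_le.2 (le_trans ?_ hlog)⟩
  · have := hc1 h
    rw [one_sub_div hb0.ne']
    exact div_le_div_of_nonneg_left (by linarith) hb0 (by linarith)
  · have := hc2 h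
    have : a / b ≤ 1 / 2 := by
      rw [div_le_div_iff₀ hb0 (by norm_num)]; linarith
    linarith
end
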